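/- arXiv:0906.1299 — 3 statements merged into one kernel-verified Lean document; each statement's English description precedes it below -/
import Mathlib

section
/- Let A be a Noetherian local ring, M and N finitely generated A-modules, and k ≥ 0 an integer. Then Ext^j_A(M, N) = 0 for all j < k if and only if for every prime ideal p in the support of M, the depth of the localization N_p over A_p is at least k. -/
open CategoryTheory

/-- The Ext groups of two modules over a commutative ring, as derived functors. -/
noncomputable def ExtMod (R : Type) [CommRing R] (n : ℕ) (M N : ModuleCat R) : ModuleCat R :=
  ((Ext R (ModuleCat R) n).obj (Opposite.op M)).obj N

/-- `HasDepthGE R I M n` : the `I`-depth of `M` is at least `n`, expressed by the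
existence of a weakly regular sequence of length `n` with entries in `I` (for the
zero module this holds for every `n`, matching the convention `depth 0 = ∞`). -/
def HasDepthGE (R : Type) [CommRing R] (I : Ideal R) (M : Type) [AddCommGroup M] [Module R M]
    (n : ℕ) : Prop :=
  ∃ rs : List R, rs.length = n ∧ (∀ r ∈ rs, r ∈ I) ∧ RingTheory.Sequence.IsWeaklyRegular M rs

namespace CategoryTheory.ProjectiveResolution

variable {R : Type} [CommRing R] {X Y : ModuleCat.{0} R}

lemma subsingleton_extMod_iff (P : ProjectiveResolution X) (n : ℕ) :
    Subsingleton (ExtMod R n X Y) ↔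
      ((P.complex.linearYonedaObj R Y).sc' ((ComplexShape.up ℕ).prev n) n (n + 1)).Exact := by
  rw [ExtMod, ← ModuleCat.isZero_iff_subsingleton, (P.isoExt n Y).isZero_iff,
    ← HomologicalComplex.exactAt_iff_isZero_homology,
    HomologicalComplex.exactAt_iff' _ ((ComplexShape.up ℕ).prev n) n (n + 1) rfl (by simp)]

lemma subsingleton_extMod_zero_iff (P : ProjectiveResolution X) :
    Subsingleton (ExtMod R 0 X Y) ↔ Subsingleton (Abelian.Ext X Y 0) := by
  rw [P.subsingleton_extMod_iff, ShortComplex.moduleCat_exact_iff,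
    Abelian.Ext.addEquiv₀.subsingleton_congr]
  have hd : (P.complex.linearYonedaObj R Y).d ((ComplexShape.up ℕ).prev 0) 0 = 0 :=
    HomologicalComplex.shape _ _ _ (by simp)
  constructor
  · intro h
    refine subsingleton_of_forall_eq 0 fun f ↦ ?_
    have hcocycle : P.complex.d 1 0 ≫ P.π.f 0 ≫ f = 0 :=
      (P.complex_d_comp_π_f_zero_assoc f).trans Limits.zero_comp
    obtain ⟨g, hg⟩ := h (P.π.f 0 ≫ f : P.complex.X 0 ⟶ Y) hcocycle
    have hπ : P.π.f 0 ≫ f = 0 := hg.symm.trans (ConcreteCategory.congr_hom hd g)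
    exact (cancel_epi (P.π.f 0)).mp (hπ.trans Limits.comp_zero.symm)
  · intro h f hf
    refine ⟨0, ?_⟩
    rw [map_zero]
    let c : Limits.CokernelCofork (P.complex.d 1 0) := .ofπ f hf
    have hc := P.isColimitCokernelCofork.fac c .one
    have h0 : P.isColimitCokernelCofork.desc c = 0 := h.elim _ _
    rw [h0, Limits.comp_zero] at hc
    exact hc

lemma subsingleton_extMod_succ_iff (P : ProjectiveResolution X) (n : ℕ) :
    Subsingleton (ExtMod R (n + 1) X Y) ↔ Subsingleton (Abelian.Ext X Y (n + 1)) := by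
  rw [P.subsingleton_extMod_iff, CochainComplex.prev_nat_succ, ShortComplex.moduleCat_exact_iff]
  constructor
  · intro h
    refine subsingleton_of_forall_eq 0 fun α ↦ ?_
    obtain ⟨f, hf, rfl⟩ := P.extMk_surjective α (n + 2) rfl
    rw [P.extMk_eq_zero_iff _ _ _ _ n rfl]
    exact h f hf
  · intro h f hf
    exact (P.extMk_eq_zero_iff f (n + 2) rfl hf n rfl).mp (Subsingleton.elim _ _)

end CategoryTheory.ProjectiveResolution

/-- The left derived `Ext` and the `Ext` of the derived category vanish simultaneously. -/
lemma subsingleton_extMod_iff_subsingleton_ext {R : Type} [CommRing R] (X Y : ModuleCat.{0} R)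
    (n : ℕ) : Subsingleton (ExtMod R n X Y) ↔ Subsingleton (Abelian.Ext X Y n) := by
  cases n with
  | zero => exact (projectiveResolution X).subsingleton_extMod_zero_iff
  | succ n => exact (projectiveResolution X).subsingleton_extMod_succ_iff n

namespace HasDepthGE

variable {R : Type} [CommRing R] {I : Ideal R} {M N : Type} [AddCommGroup M] [Module R M]
  [AddCommGroup N] [Module R N] {n : ℕ}

open RingTheory.Sequence

lemma of_subsingleton (I : Ideal R) (M : Type) [AddCommGroup M] [Module R M] [Subsingleton M]
    (n : ℕ) : HasDepthGE R I M n := by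
  induction n generalizing M with
  | zero => exact ⟨[], by simp⟩
  | succ n ih =>
    obtain ⟨rs, hlen, hmem, hreg⟩ := ih (QuotSMulTop (0 : R) M)
    exact ⟨0 :: rs, by simp [hlen], by simpa using hmem,
      .cons (fun _ _ _ ↦ Subsingleton.elim _ _) hreg⟩

lemma congr (e : M ≃ₗ[R] N) (h : HasDepthGE R I M n) : HasDepthGE R I N n := by
  obtain ⟨rs, hlen, hmem, hreg⟩ := h
  exact ⟨rs, hlen, hmem, (e.isWeaklyRegular_congr rs).mp hreg⟩

lemma exists_isSMulRegular (h : HasDepthGE R I M (n + 1)) : ∃ x ∈ I, IsSMulRegular M x := by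
  obtain ⟨_ | ⟨x, rs⟩, hlen, hmem, hreg⟩ := h
  · simp at hlen
  · exact ⟨x, hmem x (by simp), ((isWeaklyRegular_cons_iff M x rs).mp hreg).1⟩

lemma cons {x : R} (hxI : x ∈ I) (hx : IsSMulRegular M x)
    (h : HasDepthGE R I (QuotSMulTop x M) n) : HasDepthGE R I M (n + 1) := by
  obtain ⟨rs, hlen, hmem, hreg⟩ := h
  exact ⟨x :: rs, by simp [hlen], by simpa [hxI] using hmem, .cons hx hreg⟩

lemma atPrime (h : HasDepthGE R I M n) (p : Ideal R) [p.IsPrime] (hIp : I ≤ p) :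
    HasDepthGE (Localization.AtPrime p) (IsLocalRing.maximalIdeal (Localization.AtPrime p))
      (LocalizedModule p.primeCompl M) n := by
  obtain ⟨rs, hlen, hmem, hreg⟩ := h
  refine ⟨rs.map (algebraMap R (Localization.AtPrime p)), by simpa using hlen, ?_,
    hreg.of_isLocalizedModule _ p.primeCompl (LocalizedModule.mkLinearMap p.primeCompl M)⟩
  simp only [List.forall_mem_map]
  intro r hr
  exact (IsLocalization.AtPrime.to_map_mem_maximal_iff _ p r).mpr (hIp (hmem r hr))

lemma smul_top_lt_top [IsLocalRing R] [Module.Finite R M] [Nontrivial M]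
    (hI : I ≤ IsLocalRing.maximalIdeal R) :
    I • (⊤ : Submodule R M) < ⊤ :=
  (Submodule.top_ne_ideal_smul_of_le_jacobson_annihilator
    (hI.trans (IsLocalRing.maximalIdeal_le_jacobson _))).symm.lt_top

variable [IsNoetherianRing R]

section IsLocalRing

variable [IsLocalRing R] [Module.Finite R M]

lemma subsingleton_ext (h : HasDepthGE R I M n) (hI : I ≤ IsLocalRing.maximalIdeal R)
    [Module.Finite R N] (hN : Module.support R N ⊆ PrimeSpectrum.zeroLocus I) (i : ℕ)
    (hi : i < n) : Subsingleton (Abelian.Ext (ModuleCat.of R N) (ModuleCat.of R M) i) := by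
  rcases subsingleton_or_nontrivial M with _ | _
  · have := (ModuleCat.isZero_of_subsingleton (.of R M)).hasInjectiveDimensionLT_zero
    exact HasInjectiveDimensionLT.subsingleton (ModuleCat.of R M) 0 i (Nat.zero_le i) _
  obtain ⟨rs, rfl, hmem, hreg⟩ := h
  have hreg' := (IsLocalRing.isRegular_iff_isWeaklyRegular_of_subset_maximalIdeal (M := M)
    fun r hr ↦ hI (hmem r hr)).mpr hreg
  exact ModuleCat.subsingleton_ext_of_exists_isRegular I (.of R N) hN (.of R M)
    (smul_top_lt_top hI) rs hmem hreg' i hi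

lemma of_subsingleton_ext (hI : I ≤ IsLocalRing.maximalIdeal R)
    [Module.Finite R N] (hN : Module.support R N = PrimeSpectrum.zeroLocus I)
    (h : ∀ i < n, Subsingleton (Abelian.Ext (ModuleCat.of R N) (ModuleCat.of R M) i)) :
    HasDepthGE R I M n := by
  rcases subsingleton_or_nontrivial M with _ | _
  · exact of_subsingleton I M n
  obtain ⟨rs, hlen, hmem, hreg⟩ := ModuleCat.exists_isRegular_of_exists_subsingleton_ext I n
    (.of R M) (smul_top_lt_top hI) (.of R N) hN h
  exact ⟨rs, hlen, hmem, hreg.toIsWeaklyRegular⟩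

/-- Over a local ring, killing any regular element of the module lowers the depth by at most one. -/
lemma quotSMulTop (h : HasDepthGE R (IsLocalRing.maximalIdeal R) M (n + 1)) {x : R}
    (hx : IsSMulRegular M x) :
    HasDepthGE R (IsLocalRing.maximalIdeal R) (QuotSMulTop x M) n := by
  have hsupp : Module.support R (R ⧸ IsLocalRing.maximalIdeal R) =
      PrimeSpectrum.zeroLocus (IsLocalRing.maximalIdeal R) := by
    rw [Module.support_eq_zeroLocus, Ideal.annihilator_quotient]
  refine of_subsingleton_ext le_rfl hsupp fun i hi ↦ ?_
  have h₁ := AddCommGrpCat.isZero_of_iff_subsingleton.mpr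
    (h.subsingleton_ext le_rfl hsupp.subset i (by lia))
  have h₂ := AddCommGrpCat.isZero_of_iff_subsingleton.mpr
    (h.subsingleton_ext le_rfl hsupp.subset (i + 1) (by lia))
  have hx' : IsSMulRegular (ModuleCat.of R M) x := hx
  exact AddCommGrpCat.subsingleton_of_isZero <| ShortComplex.Exact.isZero_of_both_zeros
    (Abelian.Ext.covariant_sequence_exact₃' _ hx'.smulShortComplex_shortExact i (i + 1) rfl)
    (h₁.eq_zero_of_src _) (h₂.eq_zero_of_tgt _)

end IsLocalRing

lemma exists_isSMulRegular_of_forall_atPrime [Module.Finite R M]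
    (h : ∀ p : Ideal R, ∀ _ : p.IsPrime, I ≤ p →
      HasDepthGE (Localization.AtPrime p) (IsLocalRing.maximalIdeal (Localization.AtPrime p))
        (LocalizedModule p.primeCompl M) (n + 1)) :
    ∃ x ∈ I, IsSMulRegular M x := by
  suffices Subsingleton (R ⧸ I →ₗ[R] M) by
    obtain ⟨x, hx, hreg⟩ := IsSMulRegular.subsingleton_linearMap_iff.mp this
    exact ⟨x, by rwa [Ideal.annihilator_quotient] at hx, hreg⟩
  refine subsingleton_of_forall_eq 0 fun f ↦ ?_
  by_contra hf
  have hf1 : f 1 ≠ 0 := fun h1 ↦ hf (Submodule.linearMap_qext _ (LinearMap.ext_ring h1))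
  obtain ⟨p, hp, hle⟩ := exists_le_isAssociatedPrime_of_isNoetherianRing R (f 1) hf1
  obtain ⟨hprime, y, hy⟩ := isAssociatedPrime_iff.mp hp
  have mem_iff (r : R) : r ∈ p ↔ r • y = 0 := by
    rw [hy, Submodule.mem_colon_singleton, Submodule.mem_bot]
  have hIp : I ≤ p := fun r hr ↦ hle <| by
    rw [Submodule.mem_colon_singleton, Submodule.mem_bot, ← map_smul]
    convert map_zero f
    exact Ideal.Quotient.eq_zero_iff_mem.mpr (by simpa using hr)
  obtain ⟨z, hz, hreg⟩ := (h p hprime hIp).exists_isSMulRegular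
  obtain ⟨r, s, rfl⟩ := IsLocalization.exists_mk'_eq p.primeCompl z
  rw [IsLocalization.AtPrime.mk'_mem_maximal_iff _ p, mem_iff] at hz
  have hy0 : LocalizedModule.mk y (1 : p.primeCompl) = 0 := hreg.right_eq_zero_of_smul <| by
    rw [IsLocalizedModule.mk_eq_mk', IsLocalizedModule.mk'_smul_mk', hz, IsLocalizedModule.mk'_zero]
  rw [IsLocalizedModule.mk_eq_mk', IsLocalizedModule.mk'_eq_zero'] at hy0
  obtain ⟨u, hu⟩ := hy0
  exact u.2 ((mem_iff u).mpr hu)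

/-- The `I`-depth is bounded below by the local depths at the primes containing `I`. -/
lemma of_forall_atPrime [Module.Finite R M]
    (h : ∀ p : Ideal R, ∀ _ : p.IsPrime, I ≤ p →
      HasDepthGE (Localization.AtPrime p) (IsLocalRing.maximalIdeal (Localization.AtPrime p))
        (LocalizedModule p.primeCompl M) n) :
    HasDepthGE R I M n := by
  induction n generalizing M with
  | zero => exact ⟨[], by simp⟩
  | succ n ih =>
    obtain ⟨x, hxI, hx⟩ := exists_isSMulRegular_of_forall_atPrime h
    refine cons hxI hx (ih fun p hp hIp ↦ ?_)
    let S := Localization.AtPrime p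
    have hx' : IsSMulRegular (LocalizedModule p.primeCompl M) (algebraMap R S x) :=
      hx.of_flat_of_isBaseChange (IsLocalizedModule.isBaseChange p.primeCompl S
        (LocalizedModule.mkLinearMap p.primeCompl M))
    refine ((h p hp hIp).quotSMulTop hx').congr ?_
    exact QuotSMulTop.congr _ (LocalizedModule.equivTensorProduct p.primeCompl M) ≪≫ₗ
      QuotSMulTop.algebraMapTensorEquivTensorQuotSMulTop x M S ≪≫ₗ
      (LocalizedModule.equivTensorProduct p.primeCompl (QuotSMulTop x M)).symm

end HasDepthGE

/-- Let `A` be a Noetherian local ring, `M` and `N` finitely generated `A`-modules and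
`k ≥ 0` an integer.  Then `Ext^j_A(M, N) = 0` for all `j < k` if and only if for every
prime ideal `p` in the support of `M` (i.e. with `M_p ≠ 0`), the depth of `N_p` over
`A_p` is at least `k`. -/
theorem ext_vanishing_iff_depth_ge_on_support
    (A : Type) [CommRing A] [IsNoetherianRing A] [IsLocalRing A]
    (M N : Type) [AddCommGroup M] [Module A M] [AddCommGroup N] [Module A N]
    [Module.Finite A M] [Module.Finite A N] (k : ℕ) :
    (∀ j : ℕ, j < k →
        Subsingleton (ExtMod A j (ModuleCat.of A M) (ModuleCat.of A N))) ↔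
      (∀ p : Ideal A, ∀ _hp : p.IsPrime,
        Nontrivial (LocalizedModule p.primeCompl M) →
        HasDepthGE (Localization.AtPrime p)
          (IsLocalRing.maximalIdeal (Localization.AtPrime p))
          (LocalizedModule p.primeCompl N) k) := by
  simp only [subsingleton_extMod_iff_subsingleton_ext]
  have hsupp : Module.support A M = PrimeSpectrum.zeroLocus (Module.annihilator A M) :=
    Module.support_eq_zeroLocus
  rcases subsingleton_or_nontrivial M with _ | _
  · have := (ModuleCat.isZero_of_subsingleton (.of A M)).hasProjectiveDimensionLT_zero
    exact iff_of_true
      (fun j _ ↦ HasProjectiveDimensionLT.subsingleton (ModuleCat.of A M) 0 j (Nat.zero_le j) _)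
      fun p _ hM ↦ (not_subsingleton_iff_nontrivial.mpr hM inferInstance).elim
  have hI : Module.annihilator A M ≤ IsLocalRing.maximalIdeal A :=
    IsLocalRing.le_maximalIdeal <| by
      rwa [Ne, Module.annihilator_eq_top_iff, not_subsingleton_iff_nontrivial]
  have hmem (p : Ideal A) (hp : p.IsPrime) :
      Nontrivial (LocalizedModule p.primeCompl M) ↔ Module.annihilator A M ≤ p :=
    Set.ext_iff.mp hsupp ⟨p, hp⟩
  constructor
  · intro h p hp hM
    exact (HasDepthGE.of_subsingleton_ext hI hsupp h).atPrime p ((hmem p hp).mp hM)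
  · intro h
    have hdepth : HasDepthGE A (Module.annihilator A M) N k :=
      .of_forall_atPrime fun p hp hIp ↦ h p hp ((hmem p hp).mpr hIp)
    exact hdepth.subsingleton_ext hI hsupp.subset
end

section
/- Change of rings (degeneration in low degrees): let R → S be a surjective ring homomorphism with kernel generated by a regular sequence of length r, and let M be an S-module. Then Ext^i_S(M, Ext^r_R(S, R)) ≅ Ext^{i+r}_R(M, R) for all i ≥ 0, provided Ext^j_R(S, R) = 0 for j ≠ r. -/
open CategoryTheory

universe v u

namespace CategoryTheory.ProjectiveResolution

open Limits

variable {C : Type u} [Category.{v} C] [Abelian C] (R : Type v) [CommRing R] [Linear R C]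
  {X : C} (P : ProjectiveResolution X)

/-- The functor sending `Y` to the complex of modules of morphisms from `P` to `Y`. -/
noncomputable def homFunctor : C ⥤ CochainComplex (ModuleCat.{v} R) ℕ where
  obj Y := P.complex.linearYonedaObj R Y
  map {Y Z} g :=
    { f := fun i => ModuleCat.ofHom (Linear.rightComp R (P.complex.X i) g)
      comm' := fun i j _ => by
        ext x
        exact (Category.assoc _ _ _).symm }
  map_id Y := by
    ext i x
    exact Category.comp_id _
  map_comp f g := by
    ext i x
    exact (Category.assoc _ _ _).symm

instance : (homFunctor R P).Additive where
  map_add := by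
    intro Y Z f g
    ext i x
    exact Preadditive.comp_add _ _ _ _ _ _

lemma shortExact_map_homFunctor {S : ShortComplex C} (hS : S.ShortExact) :
    (S.map (homFunctor R P)).ShortExact := by
  apply HomologicalComplex.shortExact_of_degreewise_shortExact
  intro i
  have := hS.mono_f
  have := hS.epi_g
  refine { exact := ?_, mono_f := ?_, epi_g := ?_ }
  · rw [ShortComplex.moduleCat_exact_iff]
    intro (x : P.complex.X i ⟶ S.X₂) (hx : x ≫ S.g = 0)
    exact ⟨hS.exact.lift x hx, hS.exact.lift_f x hx⟩
  · rw [ModuleCat.mono_iff_injective]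
    intro (x : P.complex.X i ⟶ S.X₁) (y : P.complex.X i ⟶ S.X₁) (h : x ≫ S.f = y ≫ S.f)
    exact (cancel_mono S.f).1 h
  · rw [ModuleCat.epi_iff_surjective]
    intro (x : P.complex.X i ⟶ S.X₃)
    exact ⟨Projective.factorThru x S.g, Projective.factorThru_comp x S.g⟩

lemma isZero_homology_homFunctor_of_injective (J : C) [Injective J] (n : ℕ) :
    IsZero (((homFunctor R P).obj J).homology (n + 1)) := by
  rw [← HomologicalComplex.exactAt_iff_isZero_homology,
    HomologicalComplex.exactAt_iff' _ n (n + 1) (n + 2) (by simp) (by simp),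
    ShortComplex.moduleCat_exact_iff]
  intro (x : P.complex.X (n + 1) ⟶ J) (hx : P.complex.d (n + 2) (n + 1) ≫ x = 0)
  exact ⟨(P.exact_succ n).descToInjective x hx, (P.exact_succ n).comp_descToInjective x hx⟩

/-- The augmentation of a projective resolution, with target `X` itself. -/
noncomputable def augmentation : P.complex.X 0 ⟶ X := P.π.f 0

lemma d_augmentation : P.complex.d 1 0 ≫ P.augmentation = 0 :=
  P.complex_d_comp_π_f_zero

instance : Epi P.augmentation :=
  inferInstanceAs (Epi (P.π.f 0))

lemma exists_augmentation_comp_eq {Y : C} (x : P.complex.X 0 ⟶ Y)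
    (hx : P.complex.d 1 0 ≫ x = 0) : ∃ y : X ⟶ Y, P.augmentation ≫ y = x :=
  ⟨P.isColimitCokernelCofork.desc (CokernelCofork.ofπ x hx),
    P.isColimitCokernelCofork.fac (CokernelCofork.ofπ x hx) WalkingParallelPair.one⟩

/-- Precomposition with the augmentation, as a map to the degree zero part of the complex of
morphisms from a projective resolution. -/
noncomputable def homToX (Y : C) :
    ModuleCat.of R (X ⟶ Y) ⟶ ((homFunctor R P).obj Y).X 0 :=
  ModuleCat.ofHom (Linear.leftComp R Y P.augmentation)

/-- Morphisms `X ⟶ Y`, seen as degree zero cocycles of the complex of morphisms from a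
projective resolution of `X` to `Y`. -/
noncomputable def homToCycles (Y : C) :
    ModuleCat.of R (X ⟶ Y) ⟶ ((homFunctor R P).obj Y).cycles 0 :=
  HomologicalComplex.liftCycles _ (homToX R P Y) 1 (by simp) (by
    ext (f : X ⟶ Y)
    change P.complex.d 1 0 ≫ P.augmentation ≫ f = 0
    rw [← Category.assoc, d_augmentation, zero_comp])

lemma homToCycles_iCycles (Y : C) :
    homToCycles R P Y ≫ ((homFunctor R P).obj Y).iCycles 0 = homToX R P Y :=
  HomologicalComplex.liftCycles_i _ (homToX R P Y) 1 (by simp) _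

instance (Y : C) : IsIso (homToCycles R P Y) := by
  have : Mono (homToCycles R P Y) := by
    have : Mono (homToCycles R P Y ≫ ((homFunctor R P).obj Y).iCycles 0) := by
      rw [homToCycles_iCycles, ModuleCat.mono_iff_injective]
      intro (f : X ⟶ Y) (g : X ⟶ Y) h
      exact (cancel_epi P.augmentation).1 h
    exact mono_of_mono _ (((homFunctor R P).obj Y).iCycles 0)
  have : Epi (homToCycles R P Y) := by
    rw [ModuleCat.epi_iff_surjective]
    intro c
    obtain ⟨y, hy⟩ := P.exists_augmentation_comp_eq (((homFunctor R P).obj Y).iCycles 0 c)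
      congr($(((homFunctor R P).obj Y).iCycles_d 0 1) c)
    refine ⟨y, ?_⟩
    apply (ModuleCat.mono_iff_injective (((homFunctor R P).obj Y).iCycles 0)).1 inferInstance
    rw [← ConcreteCategory.comp_apply, homToCycles_iCycles]
    exact hy
  exact isIso_of_mono_of_epi _

/-- Morphisms `X ⟶ Y` are the degree zero cohomology of the complex of morphisms from a
projective resolution of `X` to `Y`. -/
noncomputable def homIsoHomology (Y : C) :
    ModuleCat.of R (X ⟶ Y) ≅ ((homFunctor R P).obj Y).homology 0 :=
  asIso (homToCycles R P Y) ≪≫ CochainComplex.isoHomologyπ₀ _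

lemma homIsoHomology_naturality {Y Z : C} (g : Y ⟶ Z) :
    (homIsoHomology R P Y).hom ≫ HomologicalComplex.homologyMap ((homFunctor R P).map g) 0 =
      ModuleCat.ofHom (Linear.rightComp R X g) ≫ (homIsoHomology R P Z).hom := by
  have h : homToCycles R P Y ≫ HomologicalComplex.cyclesMap ((homFunctor R P).map g) 0 =
      ModuleCat.ofHom (Linear.rightComp R X g) ≫ homToCycles R P Z := by
    rw [← cancel_mono (((homFunctor R P).obj Z).iCycles 0), Category.assoc, Category.assoc,
      HomologicalComplex.cyclesMap_i, reassoc_of% homToCycles_iCycles R P Y,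
      homToCycles_iCycles]
    ext f
    exact Category.assoc _ _ _
  simp [homIsoHomology, reassoc_of% h]

end CategoryTheory.ProjectiveResolution

section ExtMod

open Limits

variable {R : Type} [CommRing R]

/-- `ExtMod` computed by the functor of morphisms from the chosen projective resolution. -/
noncomputable def extModIso (n : ℕ) (M N : ModuleCat R) :
    ExtMod R n M N ≅
      (((projectiveResolution M).homFunctor R).obj N).homology n :=
  (projectiveResolution M).isoExt n N

/-- `ExtMod` respects isomorphisms in the second variable. -/
noncomputable def extModCongrRight (n : ℕ) (M : ModuleCat R) {N N' : ModuleCat R} (e : N ≅ N') :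
    ExtMod R n M N ≃ₗ[R] ExtMod R n M N' :=
  (((Ext R (ModuleCat R) n).obj (Opposite.op M)).mapIso e).toLinearEquiv

/-- `ExtMod` respects isomorphisms in the first variable. -/
noncomputable def extModCongrLeft (n : ℕ) {M M' : ModuleCat R} (N : ModuleCat R) (e : M ≅ M') :
    ExtMod R n M N ≃ₗ[R] ExtMod R n M' N :=
  (((Ext R (ModuleCat R) n).mapIso e.symm.op).app N).toLinearEquiv

/-- `Ext` in degree zero is the module of morphisms. -/
noncomputable def extModZero (M N : ModuleCat R) : ExtMod R 0 M N ≃ₗ[R] (M ⟶ N) :=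
  (extModIso 0 M N ≪≫ ((projectiveResolution M).homIsoHomology R N).symm).toLinearEquiv

variable {T : ShortComplex (ModuleCat R)}

/-- Dimension shifting in the second variable. -/
lemma nonempty_extMod_shift (hT : T.ShortExact) (n : ℕ) (M : ModuleCat R) [Injective T.X₂] :
    Nonempty (ExtMod R (n + 1) M T.X₃ ≃ₗ[R] ExtMod R (n + 2) M T.X₁) := by
  let P := projectiveResolution M
  have h (k : ℕ) := P.isZero_homology_homFunctor_of_injective R T.X₂ k
  exact ⟨(extModIso (n + 1) M T.X₃ ≪≫
    (P.shortExact_map_homFunctor R hT).δIso (n + 1) (n + 2) (by simp) (h n) (h (n + 1)) ≪≫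
    (extModIso (n + 2) M T.X₁).symm).toLinearEquiv⟩

/-- Positive degree `Ext` does not change under quotients by injective submodules. -/
lemma nonempty_extMod_equiv_of_injective_X₁ (hT : T.ShortExact) (n : ℕ) (M : ModuleCat R)
    [Injective T.X₁] :
    Nonempty (ExtMod R (n + 1) M T.X₂ ≃ₗ[R] ExtMod R (n + 1) M T.X₃) := by
  let P := projectiveResolution M
  have h (k : ℕ) := P.isZero_homology_homFunctor_of_injective R T.X₁ k
  have hP := P.shortExact_map_homFunctor R hT
  let φ : ((P.homFunctor R).obj T.X₂).homology (n + 1) ⟶ ((P.homFunctor R).obj T.X₃).homology _ :=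
    HomologicalComplex.homologyMap ((P.homFunctor R).map T.g) (n + 1)
  have : Mono φ := (hP.homology_exact₂ (n + 1)).mono_g ((h n).eq_of_src _ _)
  have : Epi φ := (hP.homology_exact₃ (n + 1) (n + 2) (by simp)).epi_f ((h (n + 1)).eq_of_tgt _ _)
  have : IsIso φ := isIso_of_mono_of_epi φ
  exact ⟨(extModIso (n + 1) M T.X₂ ≪≫ asIso φ ≪≫ (extModIso (n + 1) M T.X₃).symm).toLinearEquiv⟩

/-- `Ext` in degree one is a cokernel between modules of morphisms. -/
lemma exists_surjective_to_extMod_one (hT : T.ShortExact) (M : ModuleCat R) [Injective T.X₂] :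
    ∃ φ : (M ⟶ T.X₃) →ₗ[R] ExtMod R 1 M T.X₁, Function.Surjective φ ∧
      ∀ x, φ x = 0 ↔ ∃ y : M ⟶ T.X₂, y ≫ T.g = x := by
  let P := projectiveResolution M
  have hP := P.shortExact_map_homFunctor R hT
  let δ : ((P.homFunctor R).obj T.X₃).homology 0 ⟶ ((P.homFunctor R).obj T.X₁).homology 1 :=
    hP.δ 0 1 (by simp)
  have hδ : HomologicalComplex.homologyMap ((P.homFunctor R).map T.g) 0 ≫ δ = 0 :=
    hP.comp_δ 0 1 (by simp)
  have hex : (ShortComplex.mk _ _ hδ).Exact := hP.homology_exact₃ 0 1 (by simp)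
  have : Epi δ := hP.epi_δ 0 1 (by simp) (P.isZero_homology_homFunctor_of_injective R T.X₂ 0)
  let φ : ModuleCat.of R (M ⟶ T.X₃) ⟶ ExtMod R 1 M T.X₁ :=
    (P.homIsoHomology R T.X₃).hom ≫ δ ≫ (extModIso 1 M T.X₁).inv
  have hφ : Epi φ := epi_comp _ _
  have hg := P.homIsoHomology_naturality R T.g
  let Z := ShortComplex.mk (ModuleCat.ofHom (Linear.rightComp R M T.g)) φ (by
    dsimp only [φ]
    rw [← reassoc_of% hg, reassoc_of% hδ, zero_comp, comp_zero])
  have hZ : Z.Exact := by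
    refine ShortComplex.exact_of_iso (ShortComplex.isoMk (P.homIsoHomology R T.X₂).symm
      (P.homIsoHomology R T.X₃).symm (extModIso 1 M T.X₁).symm ?_ ?_) hex
    · dsimp [Z]
      rw [Iso.inv_comp_eq, reassoc_of% hg, Iso.hom_inv_id, Category.comp_id]
    · simp [Z, φ, P]
  refine ⟨φ.hom, (ModuleCat.epi_iff_surjective φ).1 hφ, fun x => ⟨fun hx => ?_, ?_⟩⟩
  · exact (ShortComplex.moduleCat_exact_iff Z).1 hZ x hx
  · rintro ⟨y, rfl⟩
    exact Z.moduleCat_zero_apply y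

lemma exists_comp_eq_of_subsingleton_extMod_one (hT : T.ShortExact) (M : ModuleCat R)
    [Injective T.X₂] [Subsingleton (ExtMod R 1 M T.X₁)] (f : M ⟶ T.X₃) :
    ∃ g : M ⟶ T.X₂, g ≫ T.g = f := by
  obtain ⟨φ, -, hφ⟩ := exists_surjective_to_extMod_one hT M
  exact (hφ f).1 (Subsingleton.elim _ _)

end ExtMod

/-- Two surjective linear maps with corresponding kernels have isomorphic targets. -/
lemma nonempty_linearEquiv_of_surjective {R A B X Y : Type*} [Ring R] [AddCommGroup A]
    [AddCommGroup B] [AddCommGroup X] [AddCommGroup Y] [Module R A] [Module R B] [Module R X]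
    [Module R Y] (φ : A →ₗ[R] X) (ψ : B →ₗ[R] Y) (hφ : Function.Surjective φ)
    (hψ : Function.Surjective ψ) (e : A ≃ₗ[R] B) (h : ∀ a, φ a = 0 ↔ ψ (e a) = 0) :
    Nonempty (X ≃ₗ[R] Y) :=
  ⟨(φ.quotKerEquivOfSurjective hφ).symm.trans
    ((Submodule.quotEquivOfEq _ _ (by ext a; exact h a)).trans
      ((ψ.comp e.toLinearMap).quotKerEquivOfSurjective (hψ.comp e.surjective)))⟩

/-- Two surjective additive maps with corresponding kernels have isomorphic targets. -/
lemma nonempty_addEquiv_of_surjective {A B X Y : Type*} [AddCommGroup A]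
    [AddCommGroup B] [AddCommGroup X] [AddCommGroup Y] (φ : A →+ X) (ψ : B →+ Y)
    (hφ : Function.Surjective φ) (hψ : Function.Surjective ψ) (e : A ≃+ B)
    (h : ∀ a, φ a = 0 ↔ ψ (e a) = 0) : Nonempty (X ≃+ Y) :=
  (nonempty_linearEquiv_of_surjective φ.toIntLinearMap ψ.toIntLinearMap hφ hψ
    e.toIntLinearEquiv h).map LinearEquiv.toAddEquiv

namespace CategoryTheory

lemma ShortComplex.ShortExact.injective_X₃ {C : Type*} [Category* C] [Abelian C]
    {T : ShortComplex C} (hT : T.ShortExact) [Injective T.X₁] [Injective T.X₂] :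
    Injective T.X₃ :=
  Retract.injective ⟨hT.splittingOfInjective.s, T.g, hT.splittingOfInjective.s_g⟩

lemma exists_shortExact_injective {C : Type*} [Category* C] [Abelian C]
    [EnoughInjectives C] (N : C) :
    ∃ T : ShortComplex C, T.ShortExact ∧ Injective T.X₂ ∧ T.X₁ = N :=
  ⟨ShortComplex.mk (Injective.ι N) (Limits.cokernel.π _) (Limits.cokernel.condition _),
    { exact := ShortComplex.exact_cokernel _
      mono_f := inferInstanceAs (Mono (Injective.ι N))
      epi_g := Limits.coequalizer.π_epi }, inferInstanceAs (Injective (Injective.under N)), rfl⟩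

end CategoryTheory

section ChangeOfRings

open Limits ModuleCat

variable {R S : Type} [CommRing R] [CommRing S] (f : R →+* S)

instance : (coextendScalars f).Additive :=
  (restrictCoextendScalarsAdj f).right_adjoint_additive

instance injective_coextendScalars (J : ModuleCat R) [Injective J] :
    Injective ((coextendScalars f).obj J) :=
  (restrictCoextendScalarsAdj f).map_injective J inferInstance

/-- `S`-linear maps into a coinduced module are the `R`-linear maps into the original module. -/
noncomputable def homCoextendEquiv (M : ModuleCat S) (N : ModuleCat R) :
    (M ⟶ (coextendScalars f).obj N) ≃+ ((restrictScalars f).obj M ⟶ N) :=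
  ((restrictCoextendScalarsAdj f).homAddEquiv M N).symm

lemma homCoextendEquiv_comp (M : ModuleCat S) {N N' : ModuleCat R}
    (x : M ⟶ (coextendScalars f).obj N) (g : N ⟶ N') :
    homCoextendEquiv f M N' (x ≫ (coextendScalars f).map g) = homCoextendEquiv f M N x ≫ g :=
  (restrictCoextendScalarsAdj f).homEquiv_naturality_right_symm x g

lemma exists_comp_map_iff (M : ModuleCat S) {N N' : ModuleCat R} (g : N ⟶ N')
    (x : M ⟶ (coextendScalars f).obj N') :
    (∃ y, y ≫ (coextendScalars f).map g = x) ↔ ∃ y, y ≫ g = homCoextendEquiv f M N' x := by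
  rw [(homCoextendEquiv f M N).surjective.exists]
  refine exists_congr fun y => ?_
  rw [← homCoextendEquiv_comp, EmbeddingLike.apply_eq_iff_eq]

/-- The underlying `R`-module of a coinduced module is a module of morphisms. -/
noncomputable def restrictCoextendEquiv (N : ModuleCat R) :
    ((restrictScalars f).obj (of S S) ⟶ N) ≃ₗ[R]
      (restrictScalars f).obj ((coextendScalars f).obj N) where
  toFun x := (CoextendScalars.equiv f N).symm x.hom
  invFun x := ModuleCat.ofHom (X := (restrictScalars f).obj (of S S)) (CoextendScalars.equiv f N x)
  map_add' _ _ := rfl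
  map_smul' r x := by
    apply CoextendScalars.ext
    refine LinearMap.ext fun (s : (restrictScalars f).obj (of S S)) => ?_
    refine (x.hom.map_smul r s).symm.trans (congrArg x.hom ?_)
    exact mul_comm (f r) (show S from s)
  left_inv _ := rfl
  right_inv _ := rfl

lemma exact_map_coextendScalars {T : ShortComplex (ModuleCat R)} (hT : T.ShortExact) :
    (T.map (coextendScalars f)).Exact := by
  have := hT.mono_f
  have : PreservesLimits (coextendScalars.{0, 0, 0} f) :=
    (restrictCoextendScalarsAdj f).rightAdjoint_preservesLimits
  exact ShortComplex.Exact.map_of_mono_of_preservesKernel hT.exact _ inferInstance inferInstance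

instance : (coextendScalars f).PreservesMonomorphisms :=
  (coextendScalars f).preservesMonomorphisms_of_adjunction (restrictCoextendScalarsAdj f)

lemma shortExact_map_coextendScalars {T : ShortComplex (ModuleCat R)} (hT : T.ShortExact)
    [Injective T.X₂] [Subsingleton (ExtMod R 1 ((restrictScalars f).obj (of S S)) T.X₁)] :
    (T.map (coextendScalars f)).ShortExact where
  exact := exact_map_coextendScalars f hT
  mono_f := by
    have := hT.mono_f
    exact inferInstanceAs (Mono ((coextendScalars f).map T.f))
  epi_g := by
    rw [ModuleCat.epi_iff_surjective]
    intro x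
    obtain ⟨y, hy⟩ := exists_comp_eq_of_subsingleton_extMod_one hT _
      ((restrictCoextendEquiv f T.X₃).symm x)
    refine ⟨restrictCoextendEquiv f T.X₂ y, ?_⟩
    refine Eq.trans ?_ ((restrictCoextendEquiv f T.X₃).apply_symm_apply x)
    rw [← hy]
    rfl

/-- If `Ext` from `S` to `N` vanishes in positive degrees, then change of rings holds for the
coinduced module of `N`. -/
lemma nonempty_extMod_coextendScalars (N : ModuleCat R)
    (h : ∀ j, Subsingleton (ExtMod R (j + 1) ((restrictScalars f).obj (of S S)) N))
    (M : ModuleCat S) (i : ℕ) :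
    Nonempty (ExtMod S i M ((coextendScalars f).obj N) ≃+
      ExtMod R i ((restrictScalars f).obj M) N) := by
  induction i generalizing N with
  | zero =>
    exact ⟨(extModZero _ _).toAddEquiv.trans
      ((homCoextendEquiv f M N).trans (extModZero _ _).toAddEquiv.symm)⟩
  | succ n ih =>
    obtain ⟨T, hT, hJ, rfl⟩ := exists_shortExact_injective N
    have : Subsingleton (ExtMod R 1 ((restrictScalars f).obj (of S S)) T.X₁) := h 0
    have hFT := shortExact_map_coextendScalars f hT
    have : Injective (T.map (coextendScalars f)).X₂ := injective_coextendScalars f T.X₂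
    cases n with
    | zero =>
      obtain ⟨φ, hφ, hφ'⟩ := exists_surjective_to_extMod_one hFT M
      obtain ⟨ψ, hψ, hψ'⟩ := exists_surjective_to_extMod_one hT ((restrictScalars f).obj M)
      refine nonempty_addEquiv_of_surjective φ.toAddMonoidHom ψ.toAddMonoidHom hφ hψ
        (homCoextendEquiv f M T.X₃) fun x => ?_
      exact (hφ' x).trans ((exists_comp_map_iff f M T.g x).trans (hψ' _).symm)
    | succ n =>
      obtain ⟨e⟩ := ih T.X₃ fun j => by
        obtain ⟨e⟩ := nonempty_extMod_shift hT j ((restrictScalars f).obj (of S S))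
        have : Subsingleton (ExtMod R (j + 2) _ _) := h (j + 1)
        exact e.injective.subsingleton
      obtain ⟨e₁⟩ := nonempty_extMod_shift hFT n M
      obtain ⟨e₂⟩ := nonempty_extMod_shift hT n ((restrictScalars f).obj M)
      exact ⟨e₁.symm.toAddEquiv.trans (e.trans e₂.toAddEquiv)⟩

variable {f} in
/-- For a surjective ring homomorphism, `R`-linear isomorphisms of `S`-modules are `S`-linear. -/
noncomputable def isoOfRestrictScalars (hf : Function.Surjective f) {Q Q' : ModuleCat S}
    (e : (restrictScalars f).obj Q ≃ₗ[R] (restrictScalars f).obj Q') : Q ≅ Q' :=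
  LinearEquiv.toModuleIso
    { toFun := fun x => e x
      invFun := fun x => e.symm x
      map_add' := e.map_add
      map_smul' := fun s x => by
        obtain ⟨r, rfl⟩ := hf s
        exact e.map_smul r x
      left_inv := e.left_inv
      right_inv := e.right_inv }

variable {f} in
/-- Change of rings for `Ext` when `Ext` from `S` to `N` is concentrated in degree `r + 1` and the
coinduced module of `N` is injective. -/
lemma nonempty_extMod_changeOfRings (hf : Function.Surjective f) (r : ℕ) (N : ModuleCat R)
    (hN : Injective ((coextendScalars f).obj N))
    (h : ∀ j, j ≠ r → Subsingleton (ExtMod R (j + 1) ((restrictScalars f).obj (of S S)) N))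
    (Q : ModuleCat S)
    (e : ExtMod R (r + 1) ((restrictScalars f).obj (of S S)) N ≃ₗ[R] (restrictScalars f).obj Q)
    (M : ModuleCat S) (i : ℕ) :
    Nonempty (ExtMod S i M Q ≃+ ExtMod R (i + (r + 1)) ((restrictScalars f).obj M) N) := by
  induction r generalizing N with
  | zero =>
    obtain ⟨T, hT, hJ, rfl⟩ := exists_shortExact_injective N
    have hex := exact_map_coextendScalars f hT
    have := hT.mono_f
    let F := coextendScalars f
    let U : ShortComplex (ModuleCat S) := ShortComplex.mk (F.map T.f) (cokernel.π _)
      (cokernel.condition _)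
    have hU : U.ShortExact :=
      { exact := ShortComplex.exact_cokernel _
        mono_f := inferInstanceAs (Mono (F.map T.f))
        epi_g := inferInstanceAs (Epi (cokernel.π _)) }
    have : Injective U.X₁ := hN
    have : Injective U.X₂ := injective_coextendScalars f T.X₂
    have := hU.injective_X₃
    let k : U.X₃ ⟶ F.obj T.X₃ := cokernel.desc _ (F.map T.g) (T.map F).zero
    have hk : U.g ≫ k = F.map T.g := cokernel.π_desc _ _ _
    have : Mono k := hex.mono_cokernelDesc
    let V : ShortComplex (ModuleCat S) := ShortComplex.mk k (cokernel.π _) (cokernel.condition _)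
    have hV : V.ShortExact :=
      { exact := ShortComplex.exact_cokernel _
        mono_f := inferInstanceAs (Mono k)
        epi_g := inferInstanceAs (Epi (cokernel.π _)) }
    have : Injective V.X₁ := inferInstanceAs (Injective U.X₃)
    have hlift (L : ModuleCat S) (x : L ⟶ F.obj T.X₃) :
        x ≫ V.g = 0 ↔ ∃ y : L ⟶ F.obj T.X₂, y ≫ F.map T.g = x := by
      constructor
      · intro hx
        have := hV.mono_f
        refine ⟨hV.exact.lift x hx ≫ hU.splittingOfInjective.s, ?_⟩
        rw [← hk, Category.assoc, hU.splittingOfInjective.s_g_assoc]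
        exact hV.exact.lift_f x hx
      · rintro ⟨y, rfl⟩
        rw [← hk, Category.assoc, Category.assoc]
        exact (congr(y ≫ U.g ≫ $V.zero)).trans (by rw [comp_zero, comp_zero])
    obtain ⟨eQ⟩ : Nonempty (V.X₃ ≅ Q) := by
      obtain ⟨ψ, hψ, hψ'⟩ :=
        exists_surjective_to_extMod_one hT ((restrictScalars f).obj (of S S))
      have := hV.epi_g
      obtain ⟨e'⟩ := nonempty_linearEquiv_of_surjective ψ ((restrictScalars f).map V.g).hom hψ
        ((ModuleCat.epi_iff_surjective V.g).1 inferInstance)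
        (restrictCoextendEquiv f T.X₃) fun x => by
          refine (hψ' x).trans ⟨?_, fun hx => ?_⟩
          · rintro ⟨y, rfl⟩
            have := (hlift _ (F.map T.g)).2 ⟨𝟙 _, Category.id_comp _⟩
            exact congr($this (restrictCoextendEquiv f T.X₂ y))
          · have h₁ := hV.exact
            rw [ShortComplex.moduleCat_exact_iff] at h₁
            obtain ⟨z, hz⟩ := h₁ (restrictCoextendEquiv f T.X₃ x) hx
            obtain ⟨y, rfl⟩ := (ModuleCat.epi_iff_surjective U.g).1 hU.epi_g z
            refine ⟨(restrictCoextendEquiv f T.X₂).symm y, ?_⟩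
            apply (restrictCoextendEquiv f T.X₃).injective
            exact congr($hk y).symm.trans hz
      exact ⟨isoOfRestrictScalars hf (e'.symm.trans e)⟩
    obtain ⟨e'⟩ : Nonempty (ExtMod S i M V.X₃ ≃+
        ExtMod R (i + 1) ((restrictScalars f).obj M) T.X₁) := by
      cases i with
      | zero =>
        obtain ⟨ψ, hψ, hψ'⟩ := exists_surjective_to_extMod_one hT ((restrictScalars f).obj M)
        obtain ⟨e⟩ := nonempty_addEquiv_of_surjective
          (Preadditive.rightComp M V.g) ψ.toAddMonoidHom
          (fun x => ⟨x ≫ hV.splittingOfInjective.s,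
            show (x ≫ hV.splittingOfInjective.s) ≫ V.g = x by
              rw [Category.assoc, hV.splittingOfInjective.s_g, Category.comp_id]⟩) hψ
          (homCoextendEquiv f M T.X₃) fun x =>
            (hlift M x).trans ((exists_comp_map_iff f M T.g x).trans (hψ' _).symm)
        exact ⟨(extModZero M V.X₃).toAddEquiv.trans e⟩
      | succ n =>
        obtain ⟨e₁⟩ := nonempty_extMod_equiv_of_injective_X₁ hV n M
        obtain ⟨e₂⟩ := nonempty_extMod_coextendScalars f T.X₃ (fun j => by
          obtain ⟨e⟩ := nonempty_extMod_shift hT j ((restrictScalars f).obj (of S S))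
          have : Subsingleton (ExtMod R (j + 2) _ _) := h (j + 1) (by simp)
          exact e.injective.subsingleton) M (n + 1)
        obtain ⟨e₃⟩ := nonempty_extMod_shift hT n ((restrictScalars f).obj M)
        exact ⟨e₁.symm.toAddEquiv.trans (e₂.trans e₃.toAddEquiv)⟩
    exact ⟨(extModCongrRight i M eQ.symm).toAddEquiv.trans e'⟩
  | succ r ih =>
    obtain ⟨T, hT, hJ, rfl⟩ := exists_shortExact_injective N
    have : Subsingleton (ExtMod R 1 ((restrictScalars f).obj (of S S)) T.X₁) := h 0 (by simp)
    have hFT := shortExact_map_coextendScalars f hT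
    have : Injective (T.map (coextendScalars f)).X₁ := hN
    have : Injective (T.map (coextendScalars f)).X₂ := injective_coextendScalars f T.X₂
    have hs (j : ℕ) := nonempty_extMod_shift hT j ((restrictScalars f).obj (of S S))
    obtain ⟨e'⟩ := hs r
    obtain ⟨e₁⟩ := ih T.X₃ hFT.injective_X₃ (fun j hj => by
      obtain ⟨e⟩ := hs j
      have : Subsingleton (ExtMod R (j + 2) _ _) := h (j + 1) (by simpa using hj)
      exact e.injective.subsingleton) (e'.trans e)
    obtain ⟨e₂⟩ := nonempty_extMod_shift hT (i + r) ((restrictScalars f).obj M)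
    exact ⟨e₁.trans e₂.toAddEquiv⟩

end ChangeOfRings

/-- Restricting scalars along an algebra map recovers the given module structure. -/
noncomputable def restrictScalarsOfIso (R S M : Type) [CommRing R] [CommRing S] [Algebra R S]
    [AddCommGroup M] [Module S M] [Module R M] [IsScalarTower R S M] :
    ModuleCat.of R M ≅ (ModuleCat.restrictScalars (algebraMap R S)).obj (ModuleCat.of S M) :=
  let e : ModuleCat.of R M ≃ₗ[R]
      (ModuleCat.restrictScalars (algebraMap R S)).obj (ModuleCat.of S M) :=
    { toFun := fun x => x
      invFun := fun x => x
      map_add' := fun _ _ => rfl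
      map_smul' := fun r x => (algebraMap_smul S r (show M from x)).symm
      left_inv := fun _ => rfl
      right_inv := fun _ => rfl }
  e.toModuleIso

/-- Change of rings (Rees isomorphism): let `R` be a commutative Noetherian ring,
`I ⊆ R` an ideal generated by a regular sequence of length `r`, `S = R/I`, and `M`
any `S`-module.  Provided `Ext^j_R(S, R) = 0` for `j ≠ r` (with `Ext^r_R(S, R) ≅ S`
by Koszul duality), one has `Ext^i_S(M, Ext^r_R(S, R)) ≅ Ext^{i+r}_R(M, R)`,
i.e. `Ext^i_S(M, S) ≅ Ext^{i+r}_R(M, R)`, for all `i ≥ 0`. -/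
theorem rees_change_of_rings
    (R : Type) [CommRing R] [IsNoetherianRing R]
    (rs : List R) (r : ℕ) (hlen : rs.length = r)
    (hreg : RingTheory.Sequence.IsRegular R rs)
    (I : Ideal R) (hI : I = Ideal.ofList rs)
    (hvanish : ∀ j : ℕ, j ≠ r →
      Subsingleton (ExtMod R j (ModuleCat.of R (R ⧸ I)) (ModuleCat.of R R)))
    (hKoszul : Nonempty
      ((ExtMod R r (ModuleCat.of R (R ⧸ I)) (ModuleCat.of R R)) ≃ₗ[R] (R ⧸ I)))
    (M : Type) [AddCommGroup M] [Module (R ⧸ I) M]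
    [Module R M] [IsScalarTower R (R ⧸ I) M] :
    ∀ i : ℕ, Nonempty
      ((ExtMod (R ⧸ I) i (ModuleCat.of (R ⧸ I) M) (ModuleCat.of (R ⧸ I) (R ⧸ I))) ≃+
        (ExtMod R (i + r) (ModuleCat.of R M) (ModuleCat.of R R))) := by
  intro i
  let f := algebraMap R (R ⧸ I)
  have hf : Function.Surjective f := Ideal.Quotient.mk_surjective
  let S' := (ModuleCat.restrictScalars f).obj (ModuleCat.of (R ⧸ I) (R ⧸ I))
  let eS : ModuleCat.of R (R ⧸ I) ≅ S' := restrictScalarsOfIso R (R ⧸ I) (R ⧸ I)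
  let N := ModuleCat.of R R
  let M' := ModuleCat.of (R ⧸ I) M
  obtain ⟨eK⟩ := hKoszul
  let e : ExtMod R r S' N ≃ₗ[R] S' :=
    (extModCongrLeft r N eS.symm).trans (eK.trans eS.toLinearEquiv)
  have hS (j : ℕ) (hj : j ≠ r) : Subsingleton (ExtMod R j S' N) := by
    have := hvanish j hj
    exact (extModCongrLeft j N eS.symm).injective.subsingleton
  suffices h : Nonempty (ExtMod (R ⧸ I) i M' (ModuleCat.of (R ⧸ I) (R ⧸ I)) ≃+
      ExtMod R (i + r) ((ModuleCat.restrictScalars f).obj M') N) from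
    h.map fun e' => e'.trans
      (extModCongrLeft (i + r) N (restrictScalarsOfIso R (R ⧸ I) M).symm).toAddEquiv
  clear_value e
  cases r with
  | zero =>
    obtain ⟨e₁⟩ := nonempty_extMod_coextendScalars f N (fun j => hS (j + 1) (by simp)) M' i
    exact ⟨(extModCongrRight i M' (isoOfRestrictScalars hf
      (((restrictCoextendEquiv f N).symm.trans (extModZero S' N).symm).trans
        e)).symm).toAddEquiv.trans e₁⟩
  | succ r =>
    refine nonempty_extMod_changeOfRings hf r N ?_ (fun j hj => hS (j + 1) (by simpa using hj)) _ e
      M' i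
    have := hS 0 (by simp)
    have h := (extModZero S' N).symm.injective.subsingleton
    have h' : Subsingleton ((ModuleCat.coextendScalars f).obj N) :=
      (restrictCoextendEquiv f N).symm.injective.subsingleton
    exact (ModuleCat.isZero_of_subsingleton _).injective
end

section
/- For an ideal I generated by a regular sequence f_1, ..., f_r in a commutative Noetherian ring R, one has Ext^j_R(R/I, R) = 0 for j ≠ r and Ext^r_R(R/I, R) ≅ R/I. -/
open CategoryTheory

open CategoryTheory.Abelian

namespace CategoryTheory.ProjectiveResolution

open CochainComplex HomComplex in
lemma extMk_eq_zero_iff_of_degree_zero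
    {C : Type*} [Category* C] [Abelian C] [HasExt C] {X Y : C} (P : ProjectiveResolution X)
    (f : P.complex.X 0 ⟶ Y) (hf : P.complex.d 1 0 ≫ f = 0) :
    P.extMk f 1 rfl hf = 0 ↔ f = 0 := by
  refine ⟨fun h ↦ ?_, fun h ↦ by subst h; exact P.extMk_zero 1 rfl⟩
  rw [← P.extEquivCohomologyClass.apply_eq_iff_eq, P.extEquivCohomologyClass_extMk,
    P.extEquivCohomologyClass_zero, CohomologyClass.mk_eq_zero_iff,
    Cocycle.toSingleMk_mem_coboundaries_iff _ _ _ _ _ 1 (by simp)] at h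
  obtain ⟨g, hg⟩ := h
  rw [(CochainComplex.isZero_of_isStrictlyLE P.cochainComplex 0 1 (by lia)).eq_of_src g 0,
    Limits.comp_zero] at hg
  simpa using hg.symm

variable {R : Type} [CommRing R] {M N : ModuleCat.{0} R}

lemma smul_extMk (P : ProjectiveResolution M) {n : ℕ} (f : P.complex.X n ⟶ N) (m : ℕ)
    (hm : n + 1 = m) (hf : P.complex.d m n ≫ f = 0) (c : R) :
    c • P.extMk f m hm hf = P.extMk (c • f) m hm (by simp [hf]) := by
  rw [Ext.smul_eq_comp_mk₀, P.extMk_comp_mk₀]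
  simp

lemma mem_ker_linearYonedaObj_iff (P : ProjectiveResolution M) (n : ℕ)
    (f : P.complex.X n ⟶ N) : f ∈ LinearMap.ker (((P.complex.linearYonedaObj R N).sc n).g.hom) ↔
      P.complex.d (n + 1) n ≫ f = 0 := by
  have : (ComplexShape.up ℕ).next n = n + 1 := by simp
  rw [← this]
  rfl

lemma extMk_eq_zero_iff_mem_range (P : ProjectiveResolution M) (n : ℕ)
    (f : P.complex.X n ⟶ N) (hf) :
    P.extMk f (n + 1) rfl hf = 0 ↔
      f ∈ LinearMap.range (((P.complex.linearYonedaObj R N).sc n).f.hom) := by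
  have h : f ∈ LinearMap.range (((P.complex.linearYonedaObj R N).sc n).f.hom) ↔
      ∃ (g : P.complex.X ((ComplexShape.up ℕ).prev n) ⟶ N), P.complex.d _ _ ≫ g = f := Iff.rfl
  rw [h]
  cases n with
  | zero => simp [P.extMk_eq_zero_iff_of_degree_zero, eq_comm]
  | succ p =>
    rw [P.extMk_eq_zero_iff f _ rfl hf p rfl]
    have : (ComplexShape.up ℕ).prev (p + 1) = p := by simp
    rw [this]

/-- The linear map sending an `n`-cocycle of `Hom(P, N)` to its class in `Ext M N n`. -/
noncomputable def cyclesToExt (P : ProjectiveResolution M) (n : ℕ) :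
    LinearMap.ker (((P.complex.linearYonedaObj R N).sc n).g.hom) →ₗ[R] Abelian.Ext M N n where
  toFun f := P.extMk (f.1 : P.complex.X n ⟶ N) (n + 1) rfl
    ((P.mem_ker_linearYonedaObj_iff n f.1).1 f.2)
  map_add' _ _ := (P.add_extMk _ _ _ _ _ _).symm
  map_smul' _ _ := (P.smul_extMk _ _ _ _ _).symm

end CategoryTheory.ProjectiveResolution

section

variable {R : Type} [CommRing R]

/-- The derived-functor `Ext` modules agree with the `Ext` modules of the derived category. -/
lemma nonempty_extMod_linearEquiv (M N : ModuleCat.{0} R) (n : ℕ) :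
    Nonempty (ExtMod R n M N ≃ₗ[R] Abelian.Ext M N n) := by
  let P := projectiveResolution M
  let K := P.complex.linearYonedaObj R N
  have hker : LinearMap.range (K.sc n).moduleCatToCycles =
      LinearMap.ker (P.cyclesToExt (N := N) n) := by
    ext f
    rw [LinearMap.mem_ker]
    refine Iff.trans ?_ (P.extMk_eq_zero_iff_mem_range n f.1
      ((P.mem_ker_linearYonedaObj_iff n f.1).1 f.2)).symm
    exact ⟨fun ⟨g, hg⟩ ↦ ⟨g, congrArg Subtype.val hg⟩, fun ⟨g, hg⟩ ↦ ⟨g, Subtype.ext hg⟩⟩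
  have hsurj : Function.Surjective (P.cyclesToExt (N := N) n) := fun α ↦ by
    obtain ⟨f, hf, rfl⟩ := P.extMk_surjective α (n + 1) rfl
    exact ⟨⟨f, (P.mem_ker_linearYonedaObj_iff n f).2 hf⟩, rfl⟩
  exact ⟨(P.isoExt n N ≪≫ (K.sc n).moduleCatHomologyIso).toLinearEquiv ≪≫ₗ
    Submodule.quotEquivOfEq _ _ hker ≪≫ₗ LinearMap.quotKerEquivOfSurjective _ hsurj⟩

open Pointwise

/-- `Ext M N j` vanishes for `j ≠ n` and is isomorphic to `M` for `j = n`. -/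
def IsExtSelfDual (M N : ModuleCat.{0} R) (n : ℕ) : Prop :=
  (∀ j ≠ n, Subsingleton (Abelian.Ext M N j)) ∧ Nonempty (Abelian.Ext M N n ≃ₗ[R] M)

lemma IsExtSelfDual.of_linearEquiv {M M' N : ModuleCat.{0} R} {n : ℕ} (h : IsExtSelfDual M N n)
    (e : M ≃ₗ[R] M') : IsExtSelfDual M' N n := by
  let i : M ≅ M' := e.toModuleIso
  let E (j : ℕ) : Abelian.Ext M' N j ≃ₗ[R] Abelian.Ext M N j :=
    LinearEquiv.ofLinearMap ((Ext.mk₀ i.hom).precompOfLinear R N (zero_add j))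
      ((Ext.mk₀ i.inv).precompOfLinear R N (zero_add j))
      (by ext; simp) (by ext; simp)
  exact ⟨fun j hj ↦ have := h.1 j hj; (E j).toEquiv.subsingleton,
    h.2.map fun f ↦ E n ≪≫ₗ f ≪≫ₗ e⟩

/-- If `x` is `M`-regular, then the long exact sequence of `0 → M → M → M/xM → 0` shifts the degree
in which `Ext` is concentrated by one. -/
lemma IsExtSelfDual.of_shortExact {M N : ModuleCat.{0} R} {n : ℕ} (h : IsExtSelfDual M N n) {x : R}
    (hx : IsSMulRegular M x) {g : M ⟶ ModuleCat.of R (QuotSMulTop x M)} {w : (x • 𝟙 M) ≫ g = 0}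
    (hS : (ShortComplex.mk (x • 𝟙 M) g w).ShortExact) :
    IsExtSelfDual (ModuleCat.of R (QuotSMulTop x M)) N (n + 1) := by
  have hf (j : ℕ) (α : Abelian.Ext M N j) :
      (Ext.mk₀ (x • 𝟙 M)).comp α (zero_add j) = x • α := by
    rw [Ext.mk₀_smul, Ext.smul_comp]
    simp
  obtain ⟨h₀, ⟨e⟩⟩ := h
  have hreg (j : ℕ) : IsSMulRegular (Abelian.Ext M N j) x := by
    by_cases hj : j = n
    · subst hj
      exact (e.isSMulRegular_congr x).2 hx
    · have := h₀ j hj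
      exact fun _ _ _ ↦ Subsingleton.elim _ _
  have key (j : ℕ) (α : Abelian.Ext (ModuleCat.of R (QuotSMulTop x M)) N j) :
      (Ext.mk₀ g).comp α (zero_add j) = 0 := by
    apply hreg j
    beta_reduce
    rw [← hf, Ext.mk₀_comp_mk₀_assoc, w]
    simp
  refine ⟨fun j hj ↦ subsingleton_of_forall_eq 0 fun α ↦ ?_, ?_⟩
  · cases j with
    | zero =>
      have := hS.epi_g
      exact Ext.precomp_mk₀_injective_of_epi N g (by simpa using key 0 α)
    | succ j =>
      obtain ⟨β, rfl⟩ := Ext.contravariant_sequence_exact₃ hS N α (key _ α) (add_comm 1 j)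
      have := h₀ j (by lia)
      rw [Subsingleton.elim β 0, Ext.comp_zero]
  · let d : Abelian.Ext M N n →ₗ[R] Abelian.Ext (ModuleCat.of R (QuotSMulTop x M)) N (n + 1) :=
      Ext.precompOfLinear hS.extClass R N (add_comm 1 n)
    have hd : Function.Surjective d := fun α ↦
      Ext.contravariant_sequence_exact₃ hS N α (key _ α) (add_comm 1 n)
    have hk : LinearMap.ker d = x • ⊤ := by
      ext α
      rw [LinearMap.mem_ker, Submodule.mem_smul_pointwise_iff_exists]
      constructor
      · intro hα
        obtain ⟨β, rfl⟩ := Ext.contravariant_sequence_exact₁ hS N α (add_comm 1 n) hα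
        exact ⟨β, trivial, (hf n β).symm⟩
      · rintro ⟨β, -, rfl⟩
        change hS.extClass.comp _ (add_comm 1 n) = 0
        rw [← hf]
        exact hS.extClass_comp_assoc β
    exact ⟨(d.quotKerEquivOfSurjective hd).symm ≪≫ₗ Submodule.quotEquivOfEq _ _ hk ≪≫ₗ
      QuotSMulTop.congr x e⟩

lemma IsExtSelfDual.quotSMulTop {M N : ModuleCat.{0} R} {n : ℕ} (h : IsExtSelfDual M N n) {x : R}
    (hx : IsSMulRegular M x) : IsExtSelfDual (ModuleCat.of R (QuotSMulTop x M)) N (n + 1) :=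
  h.of_shortExact hx hx.smulShortComplex_shortExact

open RingTheory.Sequence in
lemma IsExtSelfDual.quot_ofList {N : ModuleCat.{0} R} {rs : List R} :
    ∀ {M : ModuleCat.{0} R} {n : ℕ}, IsExtSelfDual M N n → IsWeaklyRegular M rs →
      IsExtSelfDual (ModuleCat.of R (M ⧸ (Ideal.ofList rs • ⊤ : Submodule R M))) N
        (n + rs.length) := by
  induction rs with
  | nil =>
    intro M n h _
    exact h.of_linearEquiv (Submodule.quotEquivOfEqBot _ (by simp)).symm
  | cons x rs ih =>
    intro M n h hreg
    rw [isWeaklyRegular_cons_iff] at hreg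
    rw [List.length_cons, add_comm rs.length, ← add_assoc]
    exact (ih (h.quotSMulTop hreg.1) hreg.2).of_linearEquiv
      (Submodule.quotOfListConsSMulTopEquivQuotSMulTopInner M x rs).symm

lemma isExtSelfDual_self : IsExtSelfDual (ModuleCat.of R R) (ModuleCat.of R R) 0 := by
  refine ⟨fun j hj ↦ ?_, ⟨Ext.linearEquiv₀ ≪≫ₗ ModuleCat.homLinearEquiv (S := R) ≪≫ₗ
    LinearMap.ringLmapEquivSelf R R R⟩⟩
  obtain ⟨j, rfl⟩ := Nat.exists_eq_succ_of_ne_zero hj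
  exact Ext.subsingleton_of_projective _ _ j

end

/-- For an ideal `I` generated by a regular sequence `f_1, …, f_r` in a commutative
Noetherian ring `R`, one has `Ext^j_R(R/I, R) = 0` for `j ≠ r` and
`Ext^r_R(R/I, R) ≅ R/I`. -/
theorem ext_of_quotient_by_regular_sequence
    (R : Type) [CommRing R] [IsNoetherianRing R]
    (rs : List R) (r : ℕ) (hlen : rs.length = r)
    (hreg : RingTheory.Sequence.IsRegular R rs)
    (I : Ideal R) (hI : I = Ideal.ofList rs) :
    (∀ j : ℕ, j ≠ r →
        Subsingleton (ExtMod R j (ModuleCat.of R (R ⧸ I)) (ModuleCat.of R R))) ∧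
      Nonempty ((ExtMod R r (ModuleCat.of R (R ⧸ I)) (ModuleCat.of R R)) ≃ₗ[R] (R ⧸ I)) := by
  subst hI hlen
  have h := (isExtSelfDual_self.quot_ofList hreg.toIsWeaklyRegular).of_linearEquiv
    (M' := ModuleCat.of R (R ⧸ Ideal.ofList rs))
    (Submodule.quotEquivOfEq _ _ (by simp))
  rw [zero_add] at h
  refine ⟨fun j hj ↦ ?_, ?_⟩
  · obtain ⟨e⟩ := nonempty_extMod_linearEquiv (ModuleCat.of R (R ⧸ Ideal.ofList rs))
      (ModuleCat.of R R) j
    have := h.1 j hj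
    exact e.toEquiv.subsingleton
  · obtain ⟨e⟩ := nonempty_extMod_linearEquiv (ModuleCat.of R (R ⧸ Ideal.ofList rs))
      (ModuleCat.of R R) rs.length
    exact h.2.map e.trans
end
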